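/- arXiv:2410.04464 — 3 statements merged into one kernel-verified Lean document; each statement's English description precedes it below -/
import Mathlib

section
/- Let λ ∈ ℝ, let Y be a real random variable whose moment generating function exists in a neighborhood of the origin, let x ∈ [0,1], and let n, k ≥ 0 be integers. Then (x)_{k,λ} · ∑_{j=0}^{n} C(1−x, j) · j! · {n \brace j}_{Y,λ} = B_{k,n+k}^Y(x|λ) / C(n+k, k). -/
open MeasureTheory Filter Finset Topology

/-- The degenerate falling factorial `(x)_{n,λ} = x(x-λ)(x-2λ)⋯(x-(n-1)λ)`. -/
noncomputable def degFallFac (lam x : ℝ) : ℕ → ℝ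
  | 0 => 1
  | n + 1 => degFallFac lam x n * (x - n * lam)

/-- The degenerate exponential `e_λ^y(t) = (1+λt)^{y/λ}` for `λ ≠ 0`, and `e^{yt}` for `λ = 0`. -/
noncomputable def degExp (lam y t : ℝ) : ℝ :=
  if lam = 0 then Real.exp (y * t) else (1 + lam * t) ^ (y / lam)

/-- The generalized binomial coefficient `C(a,j) = a(a-1)⋯(a-j+1)/j!`. -/
noncomputable def genBinom (a : ℝ) (j : ℕ) : ℝ :=
  (∏ i ∈ Finset.range j, (a - (i : ℝ))) / (j.factorial : ℝ)

/-- The degenerate binomial coefficient `C_λ(x,k) = (x)_{k,λ}/k!`. -/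
noncomputable def degBinom (lam x : ℝ) (k : ℕ) : ℝ :=
  degFallFac lam x k / (k.factorial : ℝ)

open Asymptotics in
/-- If a convergent power series is `O(t ^ (N + 1))` at `0`, its coefficients up to degree `N`
vanish. -/
lemma coeff_eq_zero_of_hasSum_of_isBigO {c : ℕ → ℝ} {h : ℝ → ℝ} {N : ℕ}
    (hc : ∀ᶠ t in 𝓝 (0 : ℝ), HasSum (fun n : ℕ => c n * t ^ n) (h t))
    (hO : h =O[𝓝 0] fun t => t ^ (N + 1)) : ∀ m ≤ N, c m = 0 := by
  have hp : HasFPowerSeriesAt h (FormalMultilinearSeries.ofScalars ℝ c) 0 := by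
    rw [hasFPowerSeriesAt_iff]
    filter_upwards [hc] with t ht
    simpa [FormalMultilinearSeries.coeff_ofScalars, mul_comm] using ht
  intro m
  induction m using Nat.strong_induction_on with
  | _ m ih =>
    intro hm
    have h1 := hp.isBigO_sub_partialSum_pow (m + 1)
    have h2 : h =O[𝓝 0] fun t : ℝ => ‖t‖ ^ (m + 1) := by
      refine hO.trans (IsBigO.of_bound 1 ?_)
      filter_upwards [Metric.closedBall_mem_nhds (0 : ℝ) one_pos] with t ht
      rw [norm_pow, norm_pow, norm_norm, one_mul]
      exact pow_le_pow_of_le_one (norm_nonneg t) (mem_closedBall_zero_iff.1 ht) (by omega)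
    have hsum : ∀ t : ℝ, (FormalMultilinearSeries.ofScalars ℝ c).partialSum (m + 1) t
        = FormalMultilinearSeries.ofScalars ℝ c m fun _ => t := by
      intro t
      rw [FormalMultilinearSeries.partialSum, Finset.sum_range_succ, Finset.sum_eq_zero, zero_add]
      intro i hi
      have hi := Finset.mem_range.1 hi
      simp [FormalMultilinearSeries.ofScalars, ih i hi (by omega)]
    have h3 := h2.sub h1
    simp only [zero_add, sub_sub_cancel, hsum] at h3
    simpa [FormalMultilinearSeries.ofScalars] using h3.continuousMultilinearMap_apply_eq_zero 1

lemma ringChoose_eq_genBinom (a : ℝ) (j : ℕ) : Ring.choose a j = genBinom a j := by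
  rw [genBinom, eq_div_iff (by positivity), mul_comm, ← nsmul_eq_mul,
    ← Ring.descPochhammer_eq_factorial_smul_choose, ← descPochhammer_eval_eq_prod_range,
    ← descPochhammer_map (algebraMap ℤ ℝ), Polynomial.eval_map_algebraMap,
    Polynomial.aeval_eq_smeval]

/-- The truncated binomial expansion of `f ^ a` for `f = 1 + O(t)`. -/
lemma rpow_sub_sum_genBinom_isBigO {f : ℝ → ℝ} (a : ℝ) (n : ℕ)
    (hf : (fun t => f t - 1) =O[𝓝 0] fun t => t) :
    (fun t => f t ^ a - ∑ j ∈ range (n + 1), genBinom a j * (f t - 1) ^ j)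
      =O[𝓝 0] fun t => t ^ (n + 1) := by
  have h := (Real.one_add_rpow_hasFPowerSeriesAt_zero (a := a)).isBigO_sub_partialSum_pow (n + 1)
  have h' := (h.comp_tendsto (hf.trans_tendsto tendsto_id)).trans (hf.norm_left.pow (n + 1))
  refine h'.congr_left fun t => ?_
  simp [FormalMultilinearSeries.partialSum, FormalMultilinearSeries.coeff_ofScalars,
    binomialSeries, ringChoose_eq_genBinom, mul_comm]

lemma HasSum.mul_pow_shift {c : ℕ → ℝ} {s t : ℝ} (h : HasSum (fun n : ℕ => c n * t ^ n) s)
    (k : ℕ) : HasSum (fun m : ℕ => (if m < k then 0 else c (m - k)) * t ^ m) (t ^ k * s) := by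
  rw [← hasSum_nat_add_iff' k, Finset.sum_eq_zero, sub_zero]
  · convert! h.mul_left (t ^ k) using 2 with n
    simp only [Nat.not_lt.2 (Nat.le_add_left k n), if_false, Nat.add_sub_cancel]
    ring
  · intro i hi
    simp [Finset.mem_range.1 hi]

/-- **Theorem 2.3.** `(x)_{k,λ} ∑_{j=0}^n C(1-x,j) j! {n brace j}_{Y,λ}
= B_{k,n+k}^Y(x|λ) / C(n+k,k)`. -/
theorem degFallFac_mul_sum_stirling_eq_Bernstein_div_choose
    {Ω : Type*} [MeasurableSpace Ω] (μ : Measure Ω) [IsProbabilityMeasure μ]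
    (Y : Ω → ℝ) (hYm : Measurable Y)
    (hmgf : ∃ r > (0 : ℝ), ∀ t : ℝ, |t| < r → Integrable (fun ω => Real.exp (t * Y ω)) μ)
    (lam x : ℝ) (hx : x ∈ Set.Icc (0 : ℝ) 1)
    -- probabilistic degenerate Stirling numbers of the second kind:
    (St : ℕ → ℕ → ℝ)
    (hSt0 : ∀ n k : ℕ, n < k → St n k = 0)
    (hSt : ∀ k : ℕ, ∀ᶠ t in 𝓝 (0 : ℝ),
      HasSum (fun n : ℕ => St n k * t ^ n / (n.factorial : ℝ))
        ((1 / (k.factorial : ℝ)) * ((∫ ω, degExp lam (Y ω) t ∂μ) - 1) ^ k))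
    -- probabilistic degenerate Bernstein polynomials:
    (B : ℕ → ℕ → ℝ)
    (hB0 : ∀ k n : ℕ, n < k → B k n = 0)
    (hB : ∀ k : ℕ, ∀ᶠ t in 𝓝 (0 : ℝ),
      HasSum (fun n : ℕ => B k n * t ^ n / (n.factorial : ℝ))
        ((1 / (k.factorial : ℝ)) * degFallFac lam x k * t ^ k *
          (∫ ω, degExp lam (Y ω) t ∂μ) ^ (1 - x)))
    (n k : ℕ) :
    degFallFac lam x k * ∑ j ∈ Finset.range (n + 1),
        genBinom (1 - x) j * (j.factorial : ℝ) * St n j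
      = B k (n + k) / ((n + k).choose k : ℝ) := by
  set f : ℝ → ℝ := fun t => ∫ ω, degExp lam (Y ω) t ∂μ with hf
  have hfO : (fun t => f t - 1) =O[𝓝 0] fun t => t := by
    have hp : HasFPowerSeriesAt (fun t => f t - 1)
        (FormalMultilinearSeries.ofScalars ℝ fun m => St m 1 / (m.factorial : ℝ)) 0 := by
      rw [hasFPowerSeriesAt_iff]
      filter_upwards [hSt 1] with t ht
      simpa [FormalMultilinearSeries.coeff_ofScalars, mul_comm, mul_div_assoc, div_mul_eq_mul_div]
        using ht
    refine Asymptotics.IsBigO.of_norm_right ?_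
    simpa [FormalMultilinearSeries.partialSum, FormalMultilinearSeries.ofScalars, hSt0]
      using hp.isBigO_sub_partialSum_pow 1
  have hO := rpow_sub_sum_genBinom_isBigO (1 - x) n hfO
  set D := 1 / (k.factorial : ℝ) * degFallFac lam x k with hD
  set S : ℕ → ℝ := fun m => ∑ j ∈ Finset.range (n + 1),
    genBinom (1 - x) j * (j.factorial : ℝ) * St m j with hS
  have hsum : ∀ᶠ t in 𝓝 (0 : ℝ), HasSum (fun m : ℕ => D * (S m / (m.factorial : ℝ)) * t ^ m)
      (D * ∑ j ∈ range (n + 1), genBinom (1 - x) j * (f t - 1) ^ j) := by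
    filter_upwards [(Finset.eventually_all (range (n + 1))).2 fun j _ => hSt j] with t ht
    have h := hasSum_sum (s := range (n + 1)) fun j hj =>
      (ht j hj).mul_left (genBinom (1 - x) j * (j.factorial : ℝ))
    convert! h.mul_left D using 1
    · ext m
      simp only [hS, Finset.sum_div, Finset.sum_mul, Finset.mul_sum]
      exact Finset.sum_congr rfl fun j _ => by ring
    · congr 1
      refine Finset.sum_congr rfl fun j _ => ?_
      have : (j.factorial : ℝ) ≠ 0 := by positivity
      field_simp
      simp [hf]
  have hdiff : ∀ᶠ t in 𝓝 (0 : ℝ), HasSum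
      (fun m : ℕ => (B k m / (m.factorial : ℝ)
        - (if m < k then 0 else D * (S (m - k) / ((m - k).factorial : ℝ)))) * t ^ m)
      (D * (t ^ k * (f t ^ (1 - x)
        - ∑ j ∈ range (n + 1), genBinom (1 - x) j * (f t - 1) ^ j))) := by
    filter_upwards [hB k, hsum] with t hBt ht
    convert! hBt.sub (ht.mul_pow_shift k) using 1
    · ext m
      ring
    · simp only [hf, hD]
      ring
  have hz := coeff_eq_zero_of_hasSum_of_isBigO (N := n + k) hdiff
    ((((Asymptotics.isBigO_refl (fun t : ℝ => t ^ k) _).mul hO).const_mul_left D).congr_right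
      fun t => by ring) (n + k) le_rfl
  simp only [Nat.not_lt.2 (Nat.le_add_left k n), if_false, Nat.add_sub_cancel] at hz
  have hchoose : ((n + k).choose k : ℝ) * n.factorial * k.factorial = (n + k).factorial := by
    exact_mod_cast Nat.add_choose_mul_factorial_mul_factorial n k
  have hC : ((n + k).choose k : ℝ) ≠ 0 :=
    Nat.cast_ne_zero.2 (Nat.choose_pos (Nat.le_add_left k n)).ne'
  have hn : (n.factorial : ℝ) ≠ 0 := by positivity
  have hk : (k.factorial : ℝ) ≠ 0 := by positivity
  change degFallFac lam x k * S n = _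
  rw [← hchoose, hD] at hz
  field_simp at hz ⊢
  linarith
end

section
/- Let λ ∈ ℝ, let Y be a real random variable whose moment generating function exists in a neighborhood of the origin, let x ∈ [0,1], and let n ≥ k ≥ 0 be integers. Then B_{k,n}^Y(x|λ) = (x)_{k,λ} · ∑_{m=k}^{n} ∑_{j=0}^{m−k} C(n,m) · β_{n−m,λ}^{(k,Y)}(kx) · C(k+j, j) · C(1−x−kx, j) · j! · {m \brace k+j}_{Y,λ}. -/
open MeasureTheory Filter Finset Topology

/-- `p` is the asymptotic expansion of `f` at `0`, up to an error `O(t ^ N)`. -/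
def HasExpansion (N : ℕ) (f : ℝ → ℝ) (p : PowerSeries ℝ) : Prop :=
  (fun t => f t - (p.trunc N).eval t) =O[𝓝[≠] 0] fun t => t ^ N

lemma Polynomial.isBigO_eval_of_X_pow_dvd {N : ℕ} {P : Polynomial ℝ}
    (h : Polynomial.X ^ N ∣ P) : (fun t => P.eval t) =O[𝓝[≠] 0] fun t : ℝ => t ^ N := by
  obtain ⟨Q, rfl⟩ := h
  have hQ : (fun t => Q.eval t) =O[𝓝[≠] 0] fun _ => (1 : ℝ) :=
    (Q.continuous.tendsto 0).mono_left nhdsWithin_le_nhds |>.isBigO_one ℝ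
  simpa using (Asymptotics.isBigO_refl (fun t : ℝ => t ^ N) (𝓝[≠] 0)).mul hQ

lemma Polynomial.X_pow_dvd_of_isBigO_eval {N : ℕ} {P : Polynomial ℝ}
    (h : (fun t => P.eval t) =O[𝓝[≠] 0] fun t : ℝ => t ^ N) : Polynomial.X ^ N ∣ P := by
  induction N generalizing P with
  | zero => simp
  | succ N ih =>
    have h0 : Tendsto (fun t => P.eval t) (𝓝[≠] 0) (𝓝 0) := by
      refine h.trans_tendsto ?_
      have : Tendsto (fun t : ℝ => t ^ (N + 1)) (𝓝 0) (𝓝 (0 ^ (N + 1))) :=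
        (continuous_pow (N + 1)).tendsto 0
      simpa using this.mono_left nhdsWithin_le_nhds
    have h1 : P.eval 0 = 0 :=
      tendsto_nhds_unique ((P.continuous.tendsto 0).mono_left nhdsWithin_le_nhds) h0
    obtain ⟨Q, rfl⟩ : Polynomial.X ∣ P := by
      rw [Polynomial.X_dvd_iff, Polynomial.coeff_zero_eq_eval_zero, h1]
    rw [pow_succ']
    refine mul_dvd_mul_left _ (ih ?_)
    refine ((Asymptotics.isBigO_refl (fun t : ℝ => t⁻¹) (𝓝[≠] 0)).mul h).congr' ?_ ?_
    · filter_upwards [self_mem_nhdsWithin] with t (ht : t ≠ 0)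
      simp [ht]
    · filter_upwards [self_mem_nhdsWithin] with t (ht : t ≠ 0)
      rw [pow_succ', inv_mul_cancel_left₀ ht]

namespace HasExpansion

variable {N : ℕ} {f g : ℝ → ℝ} {p q : PowerSeries ℝ}

lemma congr' (h : HasExpansion N f p) (hfg : f =ᶠ[𝓝[≠] 0] g) : HasExpansion N g p :=
  Asymptotics.IsBigO.congr' h (hfg.mono fun t ht => by simp only [ht]) EventuallyEq.rfl

lemma coeff_eq (hp : HasExpansion N f p) (hq : HasExpansion N f q) {n : ℕ} (hn : n < N) :
    p.coeff n = q.coeff n := by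
  have h : Polynomial.X ^ N ∣ q.trunc N - p.trunc N := by
    refine Polynomial.X_pow_dvd_of_isBigO_eval ((hp.sub hq).congr_left fun t => ?_)
    simp
  have := Polynomial.X_pow_dvd_iff.1 h n hn
  simp only [Polynomial.coeff_sub, PowerSeries.coeff_trunc, hn, if_true] at this
  linarith

lemma isBigO_one (h : HasExpansion N f p) : f =O[𝓝[≠] 0] fun _ => (1 : ℝ) := by
  have h1 : (fun t : ℝ => t ^ N) =O[𝓝[≠] 0] fun _ => (1 : ℝ) :=
    ((continuous_pow N).tendsto (0 : ℝ)).mono_left nhdsWithin_le_nhds |>.isBigO_one ℝ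
  have h2 : (fun t => (p.trunc N).eval t) =O[𝓝[≠] 0] fun _ => (1 : ℝ) :=
    ((p.trunc N).continuous.tendsto 0).mono_left nhdsWithin_le_nhds |>.isBigO_one ℝ
  simpa using (Asymptotics.IsBigO.trans h h1).add h2

lemma mul (hp : HasExpansion N f p) (hq : HasExpansion N g q) :
    HasExpansion N (fun t => f t * g t) (p * q) := by
  have h1 := Asymptotics.IsBigO.mul hp hq.isBigO_one
  have h2 : (fun t => (p.trunc N).eval t) =O[𝓝[≠] 0] fun _ => (1 : ℝ) :=
    ((p.trunc N).continuous.tendsto 0).mono_left nhdsWithin_le_nhds |>.isBigO_one ℝ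
  have h3 := h2.mul hq
  have h4 : Polynomial.X ^ N ∣ p.trunc N * q.trunc N - (p * q).trunc N := by
    refine Polynomial.X_pow_dvd_iff.2 fun d hd => ?_
    rw [Polynomial.coeff_sub, sub_eq_zero, PowerSeries.coeff_trunc, if_pos hd,
      PowerSeries.coeff_mul_eq_coeff_trunc_mul_trunc p q hd]
    simp [← Polynomial.coeff_coe]
  simp only [one_mul, mul_one] at h1 h3
  refine ((h1.add h3).add (Polynomial.isBigO_eval_of_X_pow_dvd h4)).congr_left fun t => ?_
  simp only [Polynomial.eval_sub, Polynomial.eval_mul]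
  ring

lemma add_isBigO (hp : HasExpansion N f p) (hg : g =O[𝓝[≠] 0] fun t => t ^ N) :
    HasExpansion N (fun t => f t + g t) p :=
  (Asymptotics.IsBigO.add hp hg).congr_left fun t => by ring

lemma add (hp : HasExpansion N f p) (hq : HasExpansion N g q) :
    HasExpansion N (fun t => f t + g t) (p + q) :=
  (Asymptotics.IsBigO.add hp hq).congr_left fun t => by
    rw [map_add, Polynomial.eval_add]
    ring

lemma const_mul (c : ℝ) (hp : HasExpansion N f p) :
    HasExpansion N (fun t => c * f t) (PowerSeries.C c * p) :=
  (Asymptotics.IsBigO.const_mul_left hp c).congr_left fun t => by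
    rw [PowerSeries.trunc_C_mul, Polynomial.eval_mul, Polynomial.eval_C]
    ring

lemma zero : HasExpansion N (fun _ => 0) 0 := by
  simpa [HasExpansion] using Asymptotics.isBigO_zero _ _

lemma sum {ι : Type*} {s : Finset ι} {F : ι → ℝ → ℝ} {P : ι → PowerSeries ℝ}
    (h : ∀ i ∈ s, HasExpansion N (F i) (P i)) :
    HasExpansion N (fun t => ∑ i ∈ s, F i t) (∑ i ∈ s, P i) := by
  classical
  induction s using Finset.induction_on with
  | empty => simpa using zero
  | insert i s hi ih =>
    simp only [Finset.sum_insert hi]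
    exact (h i (Finset.mem_insert_self i s)).add
      (ih fun j hj => h j (Finset.mem_insert_of_mem hj))

lemma of_hasSum {a : ℕ → ℝ} (N : ℕ)
    (h : ∀ᶠ t in 𝓝[≠] (0 : ℝ), HasSum (fun n : ℕ => a n * t ^ n / (n.factorial : ℝ)) (f t)) :
    HasExpansion N f (PowerSeries.mk fun n => a n / (n.factorial : ℝ)) := by
  set b : ℕ → ℝ := fun n => a n / (n.factorial : ℝ) with hb
  have hps : HasFPowerSeriesAt (Function.update f 0 (b 0))
      (FormalMultilinearSeries.ofScalars ℝ b) 0 := by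
    rw [hasFPowerSeriesAt_iff']
    refine (eventually_nhdsWithin_iff.1 h).mono fun t ht => ?_
    by_cases h0 : t = 0
    · subst h0
      have h1 := hasSum_single (f := fun n => ((0 : ℝ) - 0) ^ n •
        (FormalMultilinearSeries.ofScalars ℝ b).coeff n) 0 fun n hn => by simp [hn]
      simpa only [Function.update_self, pow_zero, one_smul,
        FormalMultilinearSeries.coeff_ofScalars] using h1
    · rw [Function.update_of_ne h0]
      have h1 : (fun n => (t - 0) ^ n • (FormalMultilinearSeries.ofScalars ℝ b).coeff n) =
          fun n : ℕ => a n * t ^ n / (n.factorial : ℝ) := by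
        ext n
        simp only [hb, sub_zero, FormalMultilinearSeries.coeff_ofScalars, smul_eq_mul]
        ring
      rw [h1]
      exact ht h0
  have := (hps.isBigO_sub_partialSum_pow N).mono (nhdsWithin_le_nhds (s := {0}ᶜ))
  refine Asymptotics.IsBigO.congr' (this.trans (Asymptotics.isBigO_of_le _ fun t => ?_)) ?_
    EventuallyEq.rfl
  · simp
  · filter_upwards [self_mem_nhdsWithin] with t (ht : t ≠ 0)
    rw [zero_add, Function.update_of_ne ht, Polynomial.eval, PowerSeries.eval₂_trunc_eq_sum_range]
    simp [FormalMultilinearSeries.partialSum, mul_comm]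

end HasExpansion

lemma genBinom_eq_choose (a : ℝ) (j : ℕ) : genBinom a j = Ring.choose a j := by
  rw [Ring.choose_eq_smul, genBinom, ← descPochhammer_eval_eq_prod_range, smul_eq_mul,
    div_eq_inv_mul, ← Polynomial.aeval_eq_smeval, ← Polynomial.eval_map_algebraMap,
    descPochhammer_map]

/-- Taylor's formula for `(1 + u) ^ a` at `u = 0`. -/
lemma one_add_rpow_sub_sum_isBigO (a : ℝ) (N : ℕ) :
    (fun u : ℝ => (1 + u) ^ a - ∑ j ∈ Finset.range N, genBinom a j * u ^ j)
      =O[𝓝 0] fun u => u ^ N := by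
  refine ((Real.one_add_rpow_hasFPowerSeriesAt_zero (a := a)).isBigO_sub_partialSum_pow
    N).congr_left (fun u => ?_) |>.trans (Asymptotics.isBigO_of_le _ fun u => by simp)
  simp [FormalMultilinearSeries.partialSum, binomialSeries, genBinom_eq_choose, mul_comm]

lemma hasDerivAt_integral_degExp {Ω : Type*} [MeasurableSpace Ω] (μ : Measure Ω) (Y : Ω → ℝ)
    (hmgf : ∃ r > (0 : ℝ), ∀ t : ℝ, |t| < r → Integrable (fun ω => Real.exp (t * Y ω)) μ)
    (lam : ℝ) :
    HasDerivAt (fun t => ∫ ω, degExp lam (Y ω) t ∂μ) (∫ ω, Y ω ∂μ) 0 := by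
  have hint : (0 : ℝ) ∈ interior (ProbabilityTheory.integrableExpSet Y μ) := by
    obtain ⟨r, hr, h⟩ := hmgf
    rw [mem_interior_iff_mem_nhds, Metric.mem_nhds_iff]
    exact ⟨r, hr, fun t ht => h t (by simpa using ht)⟩
  have hm : HasDerivAt (ProbabilityTheory.mgf Y μ) (∫ ω, Y ω ∂μ) 0 := by
    simpa using ProbabilityTheory.hasDerivAt_mgf hint
  by_cases hl : lam = 0
  · convert hm using 1
    ext t
    simp [degExp, hl, ProbabilityTheory.mgf, mul_comm]
  · have hlog : HasDerivAt (fun t : ℝ => Real.log (1 + lam * t) / lam) 1 0 := by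
      have h1 : HasDerivAt (fun t : ℝ => 1 + lam * t) lam 0 := by
        simpa using ((hasDerivAt_id (0 : ℝ)).const_mul lam).const_add 1
      have h2 := (h1.log (by simp)).div_const lam
      simpa [hl] using h2
    have hcomp : HasDerivAt (fun t : ℝ => ProbabilityTheory.mgf Y μ (Real.log (1 + lam * t) / lam))
        (∫ ω, Y ω ∂μ) 0 := by
      have := HasDerivAt.comp (0 : ℝ) (h₂ := ProbabilityTheory.mgf Y μ) (by simpa using hm) hlog
      simpa [Function.comp_def] using this
    refine hcomp.congr_of_eventuallyEq ?_
    have hpos : ∀ᶠ t in 𝓝 (0 : ℝ), 0 < 1 + lam * t :=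
      ContinuousAt.eventually_lt (by fun_prop) (by fun_prop) (by simp)
    filter_upwards [hpos] with t ht
    simp only [ProbabilityTheory.mgf, degExp, hl, if_false]
    congr 1 with ω
    rw [Real.rpow_def_of_pos ht]
    ring_nf

/-- The expansion at `0` of `(1 / k!) (M - 1) ^ k * M ^ a`, obtained from
the powers of `M - 1`. -/
lemma hasExpansion_pow_mul_rpow {M : ℝ → ℝ} {D : ℝ} (hM : HasDerivAt M D 0) (hM0 : M 0 = 1)
    {St : ℕ → ℕ → ℝ}
    (hSt : ∀ k : ℕ, ∀ᶠ t in 𝓝 (0 : ℝ),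
      HasSum (fun n : ℕ => St n k * t ^ n / (n.factorial : ℝ))
        ((1 / (k.factorial : ℝ)) * (M t - 1) ^ k)) (k : ℕ) (a : ℝ) (N : ℕ) :
    HasExpansion N (fun t => (1 / (k.factorial : ℝ)) * (M t - 1) ^ k * M t ^ a)
      (∑ j ∈ Finset.range N, PowerSeries.C (((k + j).choose j : ℝ) * genBinom a j * j.factorial) *
        PowerSeries.mk fun m => St m (k + j) / (m.factorial : ℝ)) := by
  have hu : (fun t => M t - 1) =O[𝓝[≠] 0] fun t => t := by
    simpa [hM0] using hM.isBigO_sub.mono nhdsWithin_le_nhds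
  have hu0 : Tendsto (fun t => M t - 1) (𝓝[≠] 0) (𝓝 0) := by
    have := (hM.continuousAt.sub_const 1).mono_left (nhdsWithin_le_nhds (s := {0}ᶜ))
    simpa [hM0] using this
  have hrem := ((one_add_rpow_sub_sum_isBigO a N).comp_tendsto hu0).trans (hu.pow N)
  have hbd : (fun t => (1 / (k.factorial : ℝ)) * (M t - 1) ^ k) =O[𝓝[≠] 0] fun _ => (1 : ℝ) :=
    ((hu0.pow k).const_mul _).isBigO_one ℝ
  have hmain := (HasExpansion.sum (s := Finset.range N) fun j _ =>
    (HasExpansion.of_hasSum N ((hSt (k + j)).filter_mono nhdsWithin_le_nhds)).const_mul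
      (((k + j).choose j : ℝ) * genBinom a j * j.factorial)).add_isBigO
      (by simpa using hbd.mul hrem)
  refine hmain.congr' (Eventually.of_forall fun t => ?_)
  have : ∑ j ∈ Finset.range N, ((k + j).choose j : ℝ) * genBinom a j * j.factorial *
      ((1 / ((k + j).factorial : ℝ)) * (M t - 1) ^ (k + j)) =
      (1 / (k.factorial : ℝ)) * (M t - 1) ^ k *
        ∑ j ∈ Finset.range N, genBinom a j * (M t - 1) ^ j := by
    rw [Finset.mul_sum]
    refine Finset.sum_congr rfl fun j _ => ?_
    have h := Nat.add_choose_mul_factorial_mul_factorial k j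
    rw [← h, pow_add]
    have h3 : ((k + j).choose j : ℝ) ≠ 0 :=
      Nat.cast_ne_zero.2 (Nat.choose_pos (Nat.le_add_left j k)).ne'
    push_cast
    field_simp
  beta_reduce
  rw [this]
  ring

/-- **Theorem 2.6.** `B_{k,n}^Y(x|λ) = (x)_{k,λ} ∑_{m=k}^{n} ∑_{j=0}^{m-k} C(n,m)
β_{n-m,λ}^{(k,Y)}(kx) C(k+j,j) C(1-x-kx,j) j! {m brace k+j}_{Y,λ}`. -/
theorem probabilistic_degenerate_Bernstein_eq_double_sum_bernoulli
    {Ω : Type*} [MeasurableSpace Ω] (μ : Measure Ω) [IsProbabilityMeasure μ]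
    (Y : Ω → ℝ) (hYm : Measurable Y)
    (hmgf : ∃ r > (0 : ℝ), ∀ t : ℝ, |t| < r → Integrable (fun ω => Real.exp (t * Y ω)) μ)
    (hEY : (∫ ω, Y ω ∂μ) ≠ 0)
    (lam x : ℝ) (hx : x ∈ Set.Icc (0 : ℝ) 1)
    -- probabilistic degenerate Stirling numbers of the second kind:
    (St : ℕ → ℕ → ℝ)
    (hSt0 : ∀ n k : ℕ, n < k → St n k = 0)
    (hSt : ∀ k : ℕ, ∀ᶠ t in 𝓝 (0 : ℝ),
      HasSum (fun n : ℕ => St n k * t ^ n / (n.factorial : ℝ))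
        ((1 / (k.factorial : ℝ)) * ((∫ ω, degExp lam (Y ω) t ∂μ) - 1) ^ k))
    -- probabilistic degenerate Bernoulli polynomials of order `r`:
    (βp : ℕ → ℝ → ℕ → ℝ)
    (hβ : ∀ (r : ℕ) (y : ℝ), ∀ᶠ t in 𝓝[≠] (0 : ℝ),
      HasSum (fun n : ℕ => βp r y n * t ^ n / (n.factorial : ℝ))
        ((t / ((∫ ω, degExp lam (Y ω) t ∂μ) - 1)) ^ r *
          (∫ ω, degExp lam (Y ω) t ∂μ) ^ y))
    -- probabilistic degenerate Bernstein polynomials: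
    (B : ℕ → ℕ → ℝ)
    (hB0 : ∀ k n : ℕ, n < k → B k n = 0)
    (hB : ∀ k : ℕ, ∀ᶠ t in 𝓝 (0 : ℝ),
      HasSum (fun n : ℕ => B k n * t ^ n / (n.factorial : ℝ))
        ((1 / (k.factorial : ℝ)) * degFallFac lam x k * t ^ k *
          (∫ ω, degExp lam (Y ω) t ∂μ) ^ (1 - x)))
    (n k : ℕ) (hkn : k ≤ n) :
    B k n = degFallFac lam x k * ∑ m ∈ Finset.Icc k n, ∑ j ∈ Finset.range (m - k + 1),
      (n.choose m : ℝ) * βp k (k * x) (n - m) * ((k + j).choose j : ℝ) *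
        genBinom (1 - x - k * x) j * (j.factorial : ℝ) * St m (k + j) := by
  set M : ℝ → ℝ := fun t => ∫ ω, degExp lam (Y ω) t ∂μ with hMdef
  have hM : HasDerivAt M (∫ ω, Y ω ∂μ) 0 := hasDerivAt_integral_degExp μ Y hmgf lam
  have hM0 : M 0 = 1 := by simp [hMdef, degExp]
  have hne : ∀ᶠ t in 𝓝[≠] (0 : ℝ), M t ≠ 1 := hM.eventually_ne hEY
  have hpos : ∀ᶠ t in 𝓝[≠] (0 : ℝ), 0 < M t :=
    (hM.continuousAt.eventually_const_lt (by simp [hM0])).filter_mono nhdsWithin_le_nhds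
  have hleft := HasExpansion.of_hasSum (n + 1) ((hB k).filter_mono nhdsWithin_le_nhds)
  have hright := ((HasExpansion.of_hasSum (n + 1) (hβ k (k * x))).mul
    (hasExpansion_pow_mul_rpow hM hM0 hSt k (1 - x - k * x) (n + 1))).const_mul
      (degFallFac lam x k)
  have hcoeff := hleft.coeff_eq (hright.congr' ?_) n.lt_succ_self
  · rw [PowerSeries.coeff_mk, PowerSeries.coeff_C_mul, PowerSeries.coeff_mul,
      Finset.Nat.sum_antidiagonal_eq_sum_range_succ_mk,
      div_eq_iff (by positivity), mul_assoc] at hcoeff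
    rw [hcoeff, ← Finset.sum_range_reflect]
    congr 1
    rw [Finset.sum_mul]
    symm
    refine Finset.sum_subset_zero_on_sdiff (fun m hm => ?_) (fun m hm => ?_) (fun m hm => ?_)
    · simp only [Finset.mem_Icc, Finset.mem_range] at hm ⊢
      omega
    · simp only [Finset.mem_sdiff, Finset.mem_Icc, Finset.mem_range] at hm
      have hnm : n - (n + 1 - 1 - m) = m := by omega
      simp only [hnm, map_sum, PowerSeries.coeff_C_mul, PowerSeries.coeff_mk]
      rw [Finset.sum_eq_zero fun j _ => ?_]
      · simp
      · rw [hSt0 m (k + j) (by omega)]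
        simp
    · simp only [Finset.mem_Icc] at hm
      simp only [Nat.succ_sub_one, map_sum, PowerSeries.coeff_C_mul, PowerSeries.coeff_mk]
      rw [Nat.sub_sub_self hm.2, Finset.mul_sum, Finset.sum_mul]
      refine Finset.sum_subset_zero_on_sdiff (fun j hj => ?_) (fun j hj => ?_) (fun j _ => ?_)
      · simp only [Finset.mem_range] at hj ⊢
        omega
      · simp only [Finset.mem_sdiff, Finset.mem_range] at hj
        rw [hSt0 m (k + j) (by omega)]
        simp
      · rw [Nat.cast_choose ℝ hm.2]
        field_simp
  · filter_upwards [hne, hpos] with t ht hp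
    have h1 : M t - 1 ≠ 0 := sub_ne_zero.2 ht
    have h2 : M t ^ (1 - x) = M t ^ ((k : ℝ) * x) * M t ^ (1 - x - k * x) := by
      rw [← Real.rpow_add hp]
      ring_nf
    change degFallFac lam x k * ((t / (M t - 1)) ^ k * M t ^ ((k : ℝ) * x) *
      (1 / (k.factorial : ℝ) * (M t - 1) ^ k * M t ^ (1 - x - k * x))) =
      1 / (k.factorial : ℝ) * degFallFac lam x k * t ^ k * M t ^ (1 - x)
    rw [h2, div_pow]
    field_simp
end

section
/- Let λ ∈ ℝ, let α > 0, let Y be a Poisson random variable with parameter α, let x ∈ [0,1], and let n ≥ k ≥ 0 be integers. Then B_{k,n}^Y(x|λ)/k! = C_λ(x,k) · C(n,k) · φ_{n−k,λ}(α(1−x)). -/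
open MeasureTheory Filter Finset Topology

namespace ProbabilityTheory

/-- A real random variable with the point masses of the Poisson distribution has Poisson law. -/
theorem map_eq_map_cast_poissonMeasure {Ω : Type*} [MeasurableSpace Ω] {μ : Measure Ω}
    [IsProbabilityMeasure μ] {Y : Ω → ℝ} (hY : Measurable Y) (r : NNReal)
    (hlaw : ∀ j : ℕ, μ {ω | Y ω = (j : ℝ)}
      = ENNReal.ofReal (Real.exp (-r) * (r : ℝ) ^ j / (j.factorial : ℝ))) :
    μ.map Y = (poissonMeasure r).map (Nat.cast : ℕ → ℝ) := by
  have hemb : MeasurableEmbedding (Nat.cast : ℕ → ℝ) := .natCast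
  have : IsProbabilityMeasure (μ.map Y) := Measure.isProbabilityMeasure_map hY.aemeasurable
  have : IsProbabilityMeasure ((poissonMeasure r).map (Nat.cast : ℕ → ℝ)) :=
    Measure.isProbabilityMeasure_map hemb.measurable.aemeasurable
  have hcomap : (μ.map Y).comap (Nat.cast : ℕ → ℝ) = poissonMeasure r := by
    refine Measure.ext_of_singleton fun j => ?_
    rw [hemb.comap_apply, Set.image_singleton, Measure.map_apply hY (measurableSet_singleton _),
      poissonMeasure_singleton]
    exact hlaw j
  have hrestrict : (poissonMeasure r).map (Nat.cast : ℕ → ℝ)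
      = (μ.map Y).restrict (Set.range (Nat.cast : ℕ → ℝ)) := by
    rw [← hcomap, hemb.map_comap]
  rw [hrestrict, eq_comm]
  refine Measure.restrict_eq_self_of_ae_mem ((prob_compl_eq_zero_iff hemb.measurableSet_range).2 ?_)
  rw [← Measure.restrict_apply_univ, ← hrestrict, measure_univ]

end ProbabilityTheory

theorem degExp_natCast {lam t : ℝ} (ht : 0 ≤ 1 + lam * t) (j : ℕ) :
    degExp lam j t = degExp lam 1 t ^ j := by
  unfold degExp
  split_ifs
  · rw [← Real.exp_nat_mul]
    ring_nf
  · rw [← Real.rpow_mul_natCast ht]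
    ring_nf

/-- The probability generating function of the Poisson distribution, evaluated at `e_λ(t)`. -/
theorem integral_degExp_map_cast_poissonMeasure (r : NNReal) {lam t : ℝ} (ht : 0 ≤ 1 + lam * t) :
    ∫ y, degExp lam y t ∂((ProbabilityTheory.poissonMeasure r).map (Nat.cast : ℕ → ℝ))
      = Real.exp (r * (degExp lam 1 t - 1)) := by
  have hexp := (NormedSpace.expSeries_div_hasSum_exp
    ((r : ℝ) * degExp lam 1 t)).mul_left (Real.exp (-r))
  rw [← Real.exp_eq_exp_ℝ, ← Real.exp_add] at hexp
  rw [MeasurableEmbedding.natCast.integral_map, ProbabilityTheory.integral_poissonMeasure]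
  simp_rw [degExp_natCast ht, smul_eq_mul]
  rw [mul_sub, mul_one, sub_eq_neg_add, ← hexp.tsum_eq]
  refine tsum_congr fun j => ?_
  rw [mul_pow]
  ring

theorem hasFPowerSeriesAt_ofScalars_of_hasSum {f : ℝ → ℝ} {a : ℕ → ℝ}
    (h : ∀ᶠ t in 𝓝 (0 : ℝ), HasSum (fun n => a n * t ^ n) (f t)) :
    HasFPowerSeriesAt f (FormalMultilinearSeries.ofScalars ℝ a) 0 := by
  rw [hasFPowerSeriesAt_iff]
  simpa only [FormalMultilinearSeries.coeff_ofScalars, zero_add, smul_eq_mul, mul_comm] using h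

theorem isBigO_sub_sum_range_of_hasSum {f : ℝ → ℝ} {a : ℕ → ℝ}
    (h : ∀ᶠ t in 𝓝 (0 : ℝ), HasSum (fun n => a n * t ^ n) (f t)) (N : ℕ) :
    (fun t => f t - ∑ i ∈ range N, a i * t ^ i) =O[𝓝 0] fun t => t ^ N := by
  have := (hasFPowerSeriesAt_ofScalars_of_hasSum h).isBigO_sub_partialSum_pow N
  simp only [← norm_pow, Asymptotics.isBigO_norm_right] at this
  simpa [FormalMultilinearSeries.partialSum, FormalMultilinearSeries.coeff_ofScalars,
    FormalMultilinearSeries.apply_eq_pow_smul_coeff, mul_comm] using this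

/-- The Taylor coefficients of order less than `N` of a function that is `O(t ^ N)` vanish. -/
theorem coeff_eq_zero_of_hasSum_of_isBigO_s7 {f : ℝ → ℝ} {a : ℕ → ℝ}
    (h : ∀ᶠ t in 𝓝 (0 : ℝ), HasSum (fun n => a n * t ^ n) (f t)) {N : ℕ}
    (hf : f =O[𝓝 0] fun t => t ^ N) {n : ℕ} (hn : n < N) : a n = 0 := by
  induction n using Nat.strong_induction_on with
  | _ n ih =>
    have hfn : f =O[𝓝 0] fun t : ℝ => t ^ (n + 1) :=
      hf.trans <| (Nat.succ_le_of_lt hn).eq_or_lt.elim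
        (fun h => h ▸ Asymptotics.isBigO_refl _ _)
        fun h => (Asymptotics.isLittleO_pow_pow h).isBigO
    have hsum : ∀ t : ℝ, ∑ i ∈ range (n + 1), a i * t ^ i = a n * t ^ n := fun t => by
      rw [sum_range_succ, sum_eq_zero, zero_add]
      intro i hi
      rw [ih i (mem_range.1 hi) ((mem_range.1 hi).trans hn), zero_mul]
    have hterm : (fun t => a n * t ^ n) =O[𝓝 0] fun t : ℝ => t ^ (n + 1) := by
      simpa [hsum] using hfn.sub (isBigO_sub_sum_range_of_hasSum h (n + 1))
    by_contra ha
    have hlt : (fun t : ℝ => t ^ n) =o[𝓝 0] fun t : ℝ => t ^ n :=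
      ((Asymptotics.isBigO_const_mul_left_iff ha).1 hterm).trans_isLittleO
        (Asymptotics.isLittleO_pow_pow n.lt_succ_self)
    have hne : ∀ᶠ t : ℝ in 𝓝[≠] 0, t ^ n ≠ 0 :=
      eventually_mem_nhdsWithin.mono fun t ht => pow_ne_zero n ht
    exact Asymptotics.isLittleO_irrefl hne.frequently (hlt.mono nhdsWithin_le_nhds)

theorem hasSum_mul_pow_shift {c : ℕ → ℝ} {s t : ℝ} (k : ℕ)
    (h : HasSum (fun n => c n * t ^ n) s) :
    HasSum (fun n => (if k ≤ n then c (n - k) else 0) * t ^ n) (t ^ k * s) := by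
  rw [← (add_left_injective k).hasSum_iff]
  · refine (h.mul_left (t ^ k)).congr_fun fun n => ?_
    simp only [Function.comp_apply, le_add_iff_nonneg_left, zero_le, if_true,
      Nat.add_sub_cancel, pow_add]
    ring
  · intro n hn
    rw [if_neg, zero_mul]
    exact fun hk => hn ⟨n - k, Nat.sub_add_cancel hk⟩

/-- If `w = O(t)` and `c j` are the Taylor coefficients of `w ^ j / j!`, then the Taylor coefficient
of order `m + k` of `C * t ^ k * exp (y * w)` is `C * ∑ j ≤ m, y ^ j * c j m`. -/
theorem coeff_mul_pow_mul_exp {w : ℝ → ℝ} {c : ℕ → ℕ → ℝ} {a : ℕ → ℝ} {C y : ℝ} {k : ℕ}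
    (hw : w =O[𝓝 0] fun t => t)
    (hc : ∀ j, ∀ᶠ t in 𝓝 (0 : ℝ), HasSum (fun i => c j i * t ^ i) (w t ^ j / j.factorial))
    (ha : ∀ᶠ t in 𝓝 (0 : ℝ),
      HasSum (fun i => a i * t ^ i) (C * (t ^ k * Real.exp (y * w t)))) (m : ℕ) :
    a (m + k) = C * ∑ j ∈ range (m + 1), y ^ j * c j m := by
  have hyw := hw.const_mul_left y
  have hexp : (fun t => Real.exp (y * w t) - ∑ j ∈ range (m + 1), (y * w t) ^ j / j.factorial)
      =O[𝓝 0] fun t => t ^ (m + 1) :=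
    ((Real.exp_sub_sum_range_isBigO_pow (m + 1)).comp_tendsto
      (hyw.trans_tendsto tendsto_id)).trans (hyw.pow (m + 1))
  have hseries : ∀ᶠ t in 𝓝 (0 : ℝ), HasSum
      (fun i => (a i - C * ∑ j ∈ range (m + 1),
        y ^ j * (if k ≤ i then c j (i - k) else 0)) * t ^ i)
      (C * (t ^ k * (Real.exp (y * w t) - ∑ j ∈ range (m + 1), (y * w t) ^ j / j.factorial))) := by
    filter_upwards [ha, eventually_all.2 fun j : Fin (m + 1) => hc j] with t hat hct
    have hsum : HasSum (fun i => ∑ j ∈ range (m + 1), y ^ j *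
        ((if k ≤ i then c j (i - k) else 0) * t ^ i))
        (∑ j ∈ range (m + 1), y ^ j * (t ^ k * (w t ^ j / j.factorial))) :=
      hasSum_sum fun j hj =>
        (hasSum_mul_pow_shift k (hct ⟨j, mem_range.1 hj⟩)).mul_left (y ^ j)
    have hval : C * (t ^ k * Real.exp (y * w t))
        - C * ∑ j ∈ range (m + 1), y ^ j * (t ^ k * (w t ^ j / j.factorial))
        = C * (t ^ k * (Real.exp (y * w t) - ∑ j ∈ range (m + 1), (y * w t) ^ j / j.factorial)) := by
      rw [mul_sub, mul_sub, mul_sum (range (m + 1)) _ (t ^ k)]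
      congr 2
      exact sum_congr rfl fun j _ => by rw [mul_pow]; ring
    rw [← hval]
    refine (hat.sub (hsum.mul_left C)).congr_fun fun i => ?_
    simp only [sub_mul, mul_assoc, sum_mul]
  have hbigO : (fun t => C * (t ^ k *
      (Real.exp (y * w t) - ∑ j ∈ range (m + 1), (y * w t) ^ j / j.factorial)))
      =O[𝓝 0] fun t => t ^ (m + k + 1) := by
    simp only [show m + k + 1 = k + (m + 1) by ring, pow_add _ k]
    exact ((Asymptotics.isBigO_refl _ _).mul hexp).const_mul_left C
  have hcoeff := coeff_eq_zero_of_hasSum_of_isBigO_s7 hseries hbigO (m + k).lt_succ_self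
  simpa [sub_eq_zero] using hcoeff

/-- **Theorem 2.8.** For `Y` Poisson with parameter `α > 0`:
`B_{k,n}^Y(x|λ)/k! = C_λ(x,k) C(n,k) φ_{n-k,λ}(α(1-x))`, where
`φ_{m,λ}(y) = ∑_{j=0}^{m} {m brace j}_λ y^j` are the degenerate Bell polynomials. -/
theorem poisson_probabilistic_degenerate_Bernstein_eq_bell
    {Ω : Type*} [MeasurableSpace Ω] (μ : Measure Ω) [IsProbabilityMeasure μ]
    (Y : Ω → ℝ) (hYm : Measurable Y)
    (α : ℝ) (hα : 0 < α)
    -- `Y` is Poisson with parameter `α`: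
    (hlaw : ∀ j : ℕ, μ {ω | Y ω = (j : ℝ)}
      = ENNReal.ofReal (Real.exp (-α) * α ^ j / (j.factorial : ℝ)))
    (lam x : ℝ) (hx : x ∈ Set.Icc (0 : ℝ) 1)
    -- `dSt n k = {n brace k}_λ`, the degenerate Stirling numbers of the second kind,
    -- defined by `(1/k!)(e_λ(t)-1)^k = ∑_{n≥k} dSt n k · t^n/n!`:
    (dSt : ℕ → ℕ → ℝ)
    (hdSt0 : ∀ n k : ℕ, n < k → dSt n k = 0)
    (hdSt : ∀ k : ℕ, ∀ᶠ t in 𝓝 (0 : ℝ),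
      HasSum (fun n : ℕ => dSt n k * t ^ n / (n.factorial : ℝ))
        ((1 / (k.factorial : ℝ)) * (degExp lam 1 t - 1) ^ k))
    -- probabilistic degenerate Bernstein polynomials:
    (B : ℕ → ℕ → ℝ)
    (hB0 : ∀ k n : ℕ, n < k → B k n = 0)
    (hB : ∀ k : ℕ, ∀ᶠ t in 𝓝 (0 : ℝ),
      HasSum (fun n : ℕ => B k n * t ^ n / (n.factorial : ℝ))
        ((1 / (k.factorial : ℝ)) * degFallFac lam x k * t ^ k *
          (∫ ω, degExp lam (Y ω) t ∂μ) ^ (1 - x)))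
    (n k : ℕ) (hkn : k ≤ n) :
    B k n / (k.factorial : ℝ) = degBinom lam x k * (n.choose k : ℝ) *
      ∑ j ∈ Finset.range (n - k + 1), dSt (n - k) j * (α * (1 - x)) ^ j := by
  lift α to NNReal using hα.le
  obtain ⟨m, rfl⟩ := Nat.exists_eq_add_of_le' hkn
  have hdSt' : ∀ j, ∀ᶠ t in 𝓝 (0 : ℝ), HasSum (fun i => dSt i j / i.factorial * t ^ i)
      ((degExp lam 1 t - 1) ^ j / j.factorial) := fun j => by
    filter_upwards [hdSt j] with t ht
    simpa only [mul_div_right_comm, one_div_mul_eq_div] using ht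
  have hw : (fun t => degExp lam 1 t - 1) =O[𝓝 0] fun t => t := by
    have h1 : ∀ᶠ t in 𝓝 (0 : ℝ), HasSum (fun i => dSt i 1 / i.factorial * t ^ i)
        (degExp lam 1 t - 1) := by
      simpa using hdSt' 1
    simpa [hdSt0 0 1 one_pos] using isBigO_sub_sum_range_of_hasSum h1 1
  have hpos : ∀ᶠ t in 𝓝 (0 : ℝ), 0 ≤ 1 + lam * t := by
    have : ContinuousAt (fun t : ℝ => 1 + lam * t) 0 := by fun_prop
    exact (this.eventually_const_lt (by simp)).mono fun t ht => ht.le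
  have hmean : ∀ t, 0 ≤ 1 + lam * t → (∫ ω, degExp lam (Y ω) t ∂μ) ^ (1 - x)
      = Real.exp (α * (1 - x) * (degExp lam 1 t - 1)) := fun t ht => by
    have hmeas : Measurable fun z => degExp lam z t := by
      unfold degExp
      split_ifs <;> fun_prop
    rw [← integral_map hYm.aemeasurable hmeas.aestronglyMeasurable,
      ProbabilityTheory.map_eq_map_cast_poissonMeasure hYm α hlaw,
      integral_degExp_map_cast_poissonMeasure _ ht, ← Real.exp_mul]
    ring_nf
  have hB' : ∀ᶠ t in 𝓝 (0 : ℝ), HasSum (fun i => B k i / i.factorial * t ^ i)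
      (degBinom lam x k * (t ^ k * Real.exp (α * (1 - x) * (degExp lam 1 t - 1)))) := by
    filter_upwards [hB k, hpos] with t hBt ht
    rw [hmean t ht] at hBt
    simpa only [mul_div_right_comm, one_div_mul_eq_div, degBinom, mul_assoc] using hBt
  have hcoeff := coeff_mul_pow_mul_exp hw hdSt' hB' m
  simp only [← mul_div_assoc, ← sum_div, mul_comm _ (dSt _ _)] at hcoeff
  rw [Nat.cast_choose ℝ hkn, Nat.add_sub_cancel]
  field_simp at hcoeff ⊢
  linear_combination hcoeff
end
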